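/- The Higman group H, presented by four generators a, b, c, d subject to the relations a = [d,a], b = [a,b], c = [b,c], d = [c,d], is perfect: its abelianization is trivial, equivalently its commutator subgroup is all of H. -/

import Mathlib

open FreeGroup in
/-- The relators of the Higman group
`⟨a, b, c, d | a = [d,a], b = [a,b], c = [b,c], d = [c,d]⟩`,
where `[x,y] = x y x⁻¹ y⁻¹` and `a, b, c, d` are the generators
`0, 1, 2, 3 : Fin 4`. -/
def higmanRels : Set (FreeGroup (Fin 4)) :=
  {(of 0)⁻¹ * (of 3 * of 0 * (of 3)⁻¹ * (of 0)⁻¹),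
   (of 1)⁻¹ * (of 0 * of 1 * (of 0)⁻¹ * (of 1)⁻¹),
   (of 2)⁻¹ * (of 1 * of 2 * (of 1)⁻¹ * (of 2)⁻¹),
   (of 3)⁻¹ * (of 2 * of 3 * (of 2)⁻¹ * (of 3)⁻¹)}

open scoped commutatorElement in
/-- If a relator says `x = [y, x]`, the generator `x` lies in the commutator subgroup. -/
theorem higman_gen_mem (i j : Fin 4)
    (h : (FreeGroup.of i)⁻¹ * (FreeGroup.of j * FreeGroup.of i * (FreeGroup.of j)⁻¹ *
      (FreeGroup.of i)⁻¹) ∈ higmanRels) :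
    (PresentedGroup.of i : PresentedGroup higmanRels) ∈
      commutator (PresentedGroup higmanRels) := by
  have h1 := PresentedGroup.one_of_mem h
  simp only [map_mul, map_inv] at h1
  rw [inv_mul_eq_one] at h1
  have h2 : (PresentedGroup.of i : PresentedGroup higmanRels) =
      ⁅(PresentedGroup.of j : PresentedGroup higmanRels), PresentedGroup.of i⁆ := h1
  rw [h2, commutator_def]
  exact Subgroup.commutator_mem_commutator (Subgroup.mem_top _) (Subgroup.mem_top _)

/-- The Higman group is perfect: its commutator subgroup is the whole group. -/
theorem higmanGroup_perfect : commutator (PresentedGroup higmanRels) = ⊤ := by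
  rw [eq_top_iff, ← PresentedGroup.closure_range_of, Subgroup.closure_le]
  rintro _ ⟨i, rfl⟩
  fin_cases i
  · exact higman_gen_mem 0 3 (by simp [higmanRels])
  · exact higman_gen_mem 1 0 (by simp [higmanRels])
  · exact higman_gen_mem 2 1 (by simp [higmanRels])
  · exact higman_gen_mem 3 2 (by simp [higmanRels])
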